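/- Let H_ℤ = {A ∈ Sp(4,ℤ) : A₁₃, A₁₄, A₂₃, A₂₄, A₃₁, A₃₂, A₄₁, A₄₂ are all even}. Then the stabilizer {A ∈ H_ℤ : A·(e₁−e₃) = e₁−e₃ or A·(e₁−e₃) = −(e₁−e₃)} equals the subgroup of Sp(4,ℤ) generated by τ_{e₁}, τ_{e₃}, τ_{e₁−e₃}², −I, M²·(N′)², M²·(τ_{e₄}τ_{e₃})³ and τ_{e₄}·τ_{e₁−e₃}·τ_{e₂}²·τ_{e₁−e₃}⁻¹·τ_{e₄}⁻¹, where M is the matrix with rows (1,0,0,0), (0,1,0,1), (−1,0,1,0), (0,0,0,1), N′ is the matrix with rows (1,0,1,0), (0,1,0,0), (0,0,1,0), (0,−1,0,1), and I is the identity matrix. -/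

import Mathlib

open Matrix

abbrev M4 := Matrix (Fin 4) (Fin 4) ℤ

/-- The standard symplectic form on `ℤ⁴`: `ω(x,y) = x₁y₂ − x₂y₁ + x₃y₄ − x₄y₃`
(written with 0-based indices). -/
def omegaZ (x y : Fin 4 → ℤ) : ℤ :=
  x 0 * y 1 - x 1 * y 0 + x 2 * y 3 - x 3 * y 2

/-- `A ∈ Sp(4,ℤ)`: `A` preserves the symplectic form `ω`. -/
def IsSymp (A : M4) : Prop :=
  ∀ x y : Fin 4 → ℤ, omegaZ (A.mulVec x) (A.mulVec y) = omegaZ x y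

/-- `A ∈ H_ℤ = {A ∈ Sp(4,ℤ) : A₁₃, A₁₄, A₂₃, A₂₄, A₃₁, A₃₂, A₄₁, A₄₂ even}`
(1-based entries). -/
def InHZ (A : M4) : Prop :=
  IsSymp A ∧ (2 : ℤ) ∣ A 0 2 ∧ (2 : ℤ) ∣ A 0 3 ∧ (2 : ℤ) ∣ A 1 2 ∧ (2 : ℤ) ∣ A 1 3 ∧
    (2 : ℤ) ∣ A 2 0 ∧ (2 : ℤ) ∣ A 2 1 ∧ (2 : ℤ) ∣ A 3 0 ∧ (2 : ℤ) ∣ A 3 1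

/-- The symplectic transvection `τ_v(x) = x − ω(x,v)v`, as a matrix. -/
def tau (v : Fin 4 → ℤ) : M4 :=
  1 - Matrix.vecMulVec v ![v 1, -v 0, v 3, -v 2]

/-- The matrix `M` of the paper. -/
def Mmat : M4 := !![1, 0, 0, 0; 0, 1, 0, 1; -1, 0, 1, 0; 0, 0, 0, 1]

/-- The matrix `N′` of the paper. -/
def Npmat : M4 := !![1, 0, 1, 0; 0, 1, 0, 0; 0, 0, 1, 0; 0, -1, 0, 1]

/-- The stabilizer of `±(e₁ − e₃)` in `H_ℤ`, viewed inside `GL(4,ℤ)`. -/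
def stabCH : Set (GL (Fin 4) ℤ) :=
  {A | InHZ (A : M4) ∧
    ((A : M4).mulVec ![1, 0, -1, 0] = ![1, 0, -1, 0] ∨
     (A : M4).mulVec ![1, 0, -1, 0] = -![1, 0, -1, 0])}

/-- The generating set `τ_{e₁}`, `τ_{e₃}`, `τ_{e₁−e₃}²`, `−I`, `M²·(N′)²`,
`M²·(τ_{e₄}τ_{e₃})³` and `τ_{e₄}·τ_{e₁−e₃}·τ_{e₂}²·τ_{e₁−e₃}⁻¹·τ_{e₄}⁻¹`. -/
noncomputable def gensCH : Set (GL (Fin 4) ℤ) :=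
  {g | (g : M4) = tau ![1, 0, 0, 0]} ∪
  {g | (g : M4) = tau ![0, 0, 1, 0]} ∪
  {g | (g : M4) = (tau ![1, 0, -1, 0]) ^ 2} ∪
  {g | (g : M4) = -1} ∪
  {g | (g : M4) = Mmat ^ 2 * Npmat ^ 2} ∪
  {g | (g : M4) = Mmat ^ 2 * (tau ![0, 0, 0, 1] * tau ![0, 0, 1, 0]) ^ 3} ∪
  {g | (g : M4) =
    tau ![0, 0, 0, 1] * tau ![1, 0, -1, 0] * (tau ![0, 1, 0, 0]) ^ 2 *
      (tau ![1, 0, -1, 0])⁻¹ * (tau ![0, 0, 0, 1])⁻¹}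

/-! ### One-parameter families of matrices -/

/-- The powers of a unit whose value is `f 1`, for `f` a one-parameter family of matrices. -/
lemma coe_zpow_eq_of_additive (f : ℤ → M4) (h0 : f 0 = 1) (hadd : ∀ a b, f (a + b) = f a * f b)
    (g : GL (Fin 4) ℤ) (hg : (g : M4) = f 1) (n : ℤ) : ((g ^ n : GL (Fin 4) ℤ) : M4) = f n := by
  have hinv : ((g⁻¹ : GL (Fin 4) ℤ) : M4) = f (-1) := by
    apply Units.inv_eq_of_mul_eq_one_right
    rw [hg, ← hadd, ← h0]
    norm_num
  induction n with
  | zero => simp [h0]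
  | succ i ih => rw [_root_.zpow_add_one, Units.val_mul, ih, hg, hadd]
  | pred i ih => rw [_root_.zpow_sub_one, Units.val_mul, ih, hinv, sub_eq_add_neg, hadd]

lemma exists_mem_coe_eq_of_additive (f : ℤ → M4) (h0 : f 0 = 1)
    (hadd : ∀ a b, f (a + b) = f a * f b) (s : Set (GL (Fin 4) ℤ))
    (hs : ∀ g : GL (Fin 4) ℤ, (g : M4) = f 1 → g ∈ s) (n : ℤ) :
    ∃ g ∈ Subgroup.closure s, (g : M4) = f n := by
  let g : GL (Fin 4) ℤ := ⟨f 1, f (-1), by rw [← hadd, ← h0]; norm_num,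
    by rw [← hadd, ← h0]; norm_num⟩
  exact ⟨g ^ n, Subgroup.zpow_mem _ (Subgroup.subset_closure (hs g rfl)) n,
    coe_zpow_eq_of_additive f h0 hadd g rfl n⟩

/-- The unipotent matrices fixing `e₁` and `e₃`. -/
def shearMat (r s t : ℤ) : M4 := !![1, r, 0, s; 0, 1, 0, 0; 0, s, 1, t; 0, 0, 0, 1]

/-- The powers of `-M²N′²`. -/
def heisMat (k : ℤ) : M4 :=
  !![1 - 2 * k, 0, -2 * k, 0; 0, 1 + 2 * k, 0, -2 * k;
    2 * k, 0, 1 + 2 * k, 0; 0, 2 * k, 0, 1 - 2 * k]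

/-- The powers of `τ_w²` for `w = e₁ + e₂ - e₃ + e₄`. -/
def transMat (k : ℤ) : M4 :=
  !![1 - 2 * k, 2 * k, -2 * k, -2 * k; -2 * k, 1 + 2 * k, -2 * k, -2 * k;
    2 * k, -2 * k, 1 + 2 * k, 2 * k; -2 * k, 2 * k, -2 * k, 1 - 2 * k]

/-- The matrix `M²(τ_{e₄}τ_{e₃})³`. -/
def flipMat : M4 := !![1, 0, 0, 0; 0, 1, 0, -2; -2, 0, -1, 0; 0, 0, 0, -1]

lemma shearMat_add (r s t r' s' t' : ℤ) :
    shearMat (r + r') (s + s') (t + t') = shearMat r s t * shearMat r' s' t' := by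
  ext i j
  fin_cases i <;> fin_cases j <;> simp [shearMat, Matrix.mul_apply, Fin.sum_univ_four] <;> ring

lemma heisMat_add (a b : ℤ) : heisMat (a + b) = heisMat a * heisMat b := by
  ext i j
  fin_cases i <;> fin_cases j <;> simp [heisMat, Matrix.mul_apply, Fin.sum_univ_four] <;> ring

lemma transMat_add (a b : ℤ) : transMat (a + b) = transMat a * transMat b := by
  ext i j
  fin_cases i <;> fin_cases j <;> simp [transMat, Matrix.mul_apply, Fin.sum_univ_four] <;> ring

lemma shearMat_zero : shearMat 0 0 0 = 1 := by decide

lemma heisMat_zero : heisMat 0 = 1 := by decide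

lemma transMat_zero : transMat 0 = 1 := by decide

/-! ### The generators as explicit matrices -/

lemma tau_e1 : tau ![1, 0, 0, 0] = shearMat 1 0 0 := by decide

lemma tau_e3 : tau ![0, 0, 1, 0] = shearMat 0 0 1 := by decide

lemma tau_c_sq : tau ![1, 0, -1, 0] ^ 2 = shearMat 2 (-2) 2 := by decide +kernel

lemma Mmat_sq_mul_Npmat_sq : Mmat ^ 2 * Npmat ^ 2 = -heisMat 1 := by decide +kernel

lemma Mmat_sq_mul_tau_pow :
    Mmat ^ 2 * (tau ![0, 0, 0, 1] * tau ![0, 0, 1, 0]) ^ 3 = flipMat := by decide +kernel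

lemma tau_conj_eq : tau ![0, 0, 0, 1] * tau ![1, 0, -1, 0] * (tau ![0, 1, 0, 0]) ^ 2 *
      (tau ![1, 0, -1, 0])⁻¹ * (tau ![0, 0, 0, 1])⁻¹ = transMat 1 := by
  have h1 : (tau ![1, 0, -1, 0])⁻¹ = shearMat (-1) 1 (-1) :=
    Matrix.inv_eq_right_inv (by decide +kernel)
  have h2 : (tau ![0, 0, 0, 1])⁻¹ = !![1, 0, 0, 0; 0, 1, 0, 0; 0, 0, 1, 0; 0, 0, 1, 1] :=
    Matrix.inv_eq_right_inv (by decide +kernel)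
  rw [h1, h2]
  decide +kernel

lemma mem_gensCH_iff (g : GL (Fin 4) ℤ) : g ∈ gensCH ↔
    (g : M4) = shearMat 1 0 0 ∨ (g : M4) = shearMat 0 0 1 ∨ (g : M4) = shearMat 2 (-2) 2 ∨
    (g : M4) = -1 ∨ (g : M4) = -heisMat 1 ∨ (g : M4) = flipMat ∨ (g : M4) = transMat 1 := by
  rw [← tau_conj_eq, ← Mmat_sq_mul_tau_pow, ← Mmat_sq_mul_Npmat_sq, ← tau_c_sq, ← tau_e1,
    ← tau_e3]
  simp only [gensCH, Set.mem_union, Set.mem_ofPred_eq, or_assoc]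

/-! ### The stabilizer is a subgroup -/

lemma IsSymp.mul {A B : M4} (hA : IsSymp A) (hB : IsSymp B) : IsSymp (A * B) := fun x y => by
  rw [← Matrix.mulVec_mulVec, ← Matrix.mulVec_mulVec, hA, hB]

lemma IsSymp.inv {A : GL (Fin 4) ℤ} (hA : IsSymp (A : M4)) :
    IsSymp ((A⁻¹ : GL (Fin 4) ℤ) : M4) := fun x y => by
  rw [← hA]
  simp only [Matrix.mulVec_mulVec, Units.mul_inv, Matrix.one_mulVec]

/-- The parity conditions defining `H_ℤ` say that `A` commutes modulo `2` with a projection. -/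
lemma inHZ_iff (A : M4) : InHZ A ↔ IsSymp A ∧
    Commute (Matrix.diagonal ![1, 1, 0, 0]) ((Int.castRingHom (ZMod 2)).mapMatrix A) := by
  unfold InHZ
  refine and_congr_right fun _ => ?_
  simp only [commute_iff_eq, ← Matrix.ext_iff, Fin.forall_fin_succ, Matrix.diagonal_mul,
    Matrix.mul_diagonal]
  have h (a : ℤ) : (2 : ℤ) ∣ a ↔ (a : ZMod 2) = 0 := by
    exact_mod_cast (ZMod.intCast_zmod_eq_zero_iff_dvd a 2).symm
  simp [h, eq_comm]
  tauto

lemma InHZ.mul {A B : M4} (hA : InHZ A) (hB : InHZ B) : InHZ (A * B) := by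
  rw [inHZ_iff] at *
  exact ⟨hA.1.mul hB.1, by rw [map_mul]; exact hA.2.mul_right hB.2⟩

lemma InHZ.inv {A : GL (Fin 4) ℤ} (hA : InHZ (A : M4)) :
    InHZ ((A⁻¹ : GL (Fin 4) ℤ) : M4) := by
  rw [inHZ_iff] at *
  refine ⟨hA.1.inv, ?_⟩
  have h : Commute (Matrix.diagonal ![1, 1, 0, 0])
      ((Units.map ((Int.castRingHom (ZMod 2)).mapMatrix (m := Fin 4)).toMonoidHom A :
        (Matrix (Fin 4) (Fin 4) (ZMod 2))ˣ) : Matrix (Fin 4) (Fin 4) (ZMod 2)) := hA.2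
  exact h.units_inv_right

/-- `stabCH` as a subgroup of `GL(4,ℤ)`. -/
def stabSubgroup : Subgroup (GL (Fin 4) ℤ) where
  carrier := stabCH
  mul_mem' := by
    rintro A B ⟨hA, hA'⟩ ⟨hB, hB'⟩
    refine ⟨by rw [Units.val_mul]; exact hA.mul hB, ?_⟩
    rw [Units.val_mul, ← Matrix.mulVec_mulVec]
    rcases hA' with h | h <;> rcases hB' with h' | h' <;> simp only [h, h', Matrix.mulVec_neg] <;>
      simp
  one_mem' := by
    refine ⟨(inHZ_iff _).2 ⟨fun x y => by simp, by simp⟩, by simp⟩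
  inv_mem' := by
    rintro A ⟨hA, hA'⟩
    refine ⟨hA.inv, ?_⟩
    have key (v : Fin 4 → ℤ) : ((A⁻¹ : GL (Fin 4) ℤ) : M4).mulVec ((A : M4).mulVec v) = v := by
      rw [Matrix.mulVec_mulVec, Units.inv_mul, Matrix.one_mulVec]
    have h := key ![1, 0, -1, 0]
    rcases hA' with h' | h' <;> rw [h'] at h
    · exact Or.inl h
    · rw [Matrix.mulVec_neg] at h
      exact Or.inr (by rw [← h, neg_neg, h])

lemma mem_stabSubgroup (A : GL (Fin 4) ℤ) : A ∈ stabSubgroup ↔ InHZ (A : M4) ∧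
    ((A : M4).mulVec ![1, 0, -1, 0] = ![1, 0, -1, 0] ∨
     (A : M4).mulVec ![1, 0, -1, 0] = -![1, 0, -1, 0]) := Iff.rfl

lemma closure_le_stabSubgroup : Subgroup.closure gensCH ≤ stabSubgroup := by
  rw [Subgroup.closure_le]
  intro g hg
  change _ ∧ _
  rcases (mem_gensCH_iff g).1 hg with h | h | h | h | h | h | h <;> rw [h] <;>
  · refine ⟨⟨fun x y => ?_, by decide⟩, by decide⟩
    simp [omegaZ, shearMat, heisMat, transMat, flipMat, Matrix.mulVec, dotProduct,
      Fin.sum_univ_four, Matrix.one_apply]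
    try ring

/-! ### Members of the closure -/

lemma neg_one_mem_closure : (-1 : GL (Fin 4) ℤ) ∈ Subgroup.closure gensCH :=
  Subgroup.subset_closure ((mem_gensCH_iff _).2 (by simp))

lemma exists_coe_eq_flipMat : ∃ g ∈ Subgroup.closure gensCH, (g : M4) = flipMat := by
  have h : flipMat * flipMat = 1 := by decide
  exact ⟨⟨flipMat, flipMat, h, h⟩, Subgroup.subset_closure ((mem_gensCH_iff _).2 (by simp)), rfl⟩

lemma exists_coe_eq_transMat (k : ℤ) :
    ∃ g ∈ Subgroup.closure gensCH, (g : M4) = transMat k :=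
  exists_mem_coe_eq_of_additive transMat transMat_zero transMat_add gensCH
    (fun g hg => (mem_gensCH_iff g).2 (by simp [hg])) k

lemma exists_coe_eq_heisMat (k : ℤ) :
    ∃ g ∈ Subgroup.closure gensCH, (g : M4) = heisMat k := by
  have hmem (g : GL (Fin 4) ℤ) (hg : (g : M4) = heisMat 1) : g ∈ Subgroup.closure gensCH := by
    have h : -g ∈ Subgroup.closure gensCH :=
      Subgroup.subset_closure ((mem_gensCH_iff _).2 (by simp [hg]))
    simpa using Subgroup.mul_mem _ neg_one_mem_closure h
  obtain ⟨g, hg, h⟩ := exists_mem_coe_eq_of_additive heisMat heisMat_zero heisMat_add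
    (Subgroup.closure gensCH) hmem k
  exact ⟨g, by rwa [Subgroup.closure_eq] at hg, h⟩

lemma exists_coe_eq_shearMat (r s t : ℤ) (hs : 2 ∣ s) :
    ∃ g ∈ Subgroup.closure gensCH, (g : M4) = shearMat r s t := by
  obtain ⟨k, rfl⟩ := hs
  have z₃ : shearMat (2 * 0) (-2 * 0) (2 * 0) = 1 := by simp [shearMat_zero]
  obtain ⟨g₁, hg₁, h₁⟩ := exists_mem_coe_eq_of_additive (fun n => shearMat n 0 0) shearMat_zero
    (fun a b => by simp [← shearMat_add]) gensCH
    (fun g hg => (mem_gensCH_iff g).2 (Or.inl hg)) (r + 2 * k)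
  obtain ⟨g₂, hg₂, h₂⟩ := exists_mem_coe_eq_of_additive (fun n => shearMat 0 0 n) shearMat_zero
    (fun a b => by simp [← shearMat_add]) gensCH
    (fun g hg => (mem_gensCH_iff g).2 (Or.inr (Or.inl hg))) (t + 2 * k)
  obtain ⟨g₃, hg₃, h₃⟩ := exists_mem_coe_eq_of_additive
    (fun n => shearMat (2 * n) (-2 * n) (2 * n)) z₃
    (fun a b => by simp only [← shearMat_add, mul_add]) gensCH
    (fun g hg => (mem_gensCH_iff g).2 (by simp only [mul_one] at hg; simp [hg])) (-k)
  refine ⟨g₁ * g₂ * g₃, mul_mem (mul_mem hg₁ hg₂) hg₃, ?_⟩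
  rw [Units.val_mul, Units.val_mul, h₁, h₂, h₃, ← shearMat_add, ← shearMat_add]
  congr 1 <;> ring

/-! ### Descent -/

/-- Entrywise consequences of fixing `e₁ - e₃` and lying in `H_ℤ`. -/
lemma entries_of_fix {A : M4} (hA : InHZ A) (hfix : A.mulVec ![1, 0, -1, 0] = ![1, 0, -1, 0]) :
    (A 0 2 = A 0 0 - 1 ∧ A 1 2 = A 1 0 ∧ A 2 2 = A 2 0 + 1 ∧ A 3 2 = A 3 0) ∧
    (A 3 0 = A 1 0 ∧ A 1 1 - A 3 1 = 1 ∧ A 1 3 - A 3 3 = -1) ∧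
    A 0 0 * A 1 1 - A 1 0 * A 0 1 + A 2 0 * A 3 1 - A 3 0 * A 2 1 = 1 ∧
    A 0 0 * A 1 3 - A 1 0 * A 0 3 + A 2 0 * A 3 3 - A 3 0 * A 2 3 = 0 ∧
    A 0 1 * A 1 3 - A 1 1 * A 0 3 + A 2 1 * A 3 3 - A 3 1 * A 2 3 = 0 := by
  have f0 := congrFun hfix 0
  have f1 := congrFun hfix 1
  have f2 := congrFun hfix 2
  have f3 := congrFun hfix 3
  have s0 := hA.1 ![1, 0, -1, 0] ![1, 0, 0, 0]
  have s1 := hA.1 ![1, 0, -1, 0] ![0, 1, 0, 0]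
  have s3 := hA.1 ![1, 0, -1, 0] ![0, 0, 0, 1]
  have t1 := hA.1 ![1, 0, 0, 0] ![0, 1, 0, 0]
  have t3 := hA.1 ![1, 0, 0, 0] ![0, 0, 0, 1]
  have u3 := hA.1 ![0, 1, 0, 0] ![0, 0, 0, 1]
  rw [hfix] at s0 s1 s3
  simp [omegaZ, Matrix.mulVec, dotProduct, Fin.sum_univ_four] at f0 f1 f2 f3 s0 s1 s3 t1 t3 u3
  refine ⟨⟨?_, ?_, ?_, ?_⟩, ⟨?_, ?_, ?_⟩, ?_, ?_, ?_⟩ <;> linarith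

lemma mem_closure_of_mul {A g : GL (Fin 4) ℤ} (hg : g ∈ Subgroup.closure gensCH)
    (h : g * A ∈ Subgroup.closure gensCH) : A ∈ Subgroup.closure gensCH :=
  (Subgroup.mul_mem_cancel_left _ hg).1 h

/-- The elements of `H_ℤ` fixing `e₁ - e₃`. -/
def FixC (A : GL (Fin 4) ℤ) : Prop :=
  InHZ (A : M4) ∧ (A : M4).mulVec ![1, 0, -1, 0] = ![1, 0, -1, 0]

lemma FixC.mul {g A : GL (Fin 4) ℤ} (hA : FixC A) (hg : g ∈ Subgroup.closure gensCH)
    (hfix : (g : M4).mulVec ![1, 0, -1, 0] = ![1, 0, -1, 0]) : FixC (g * A) := by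
  have h := ((mem_stabSubgroup g).1 (closure_le_stabSubgroup hg)).1
  refine ⟨by rw [Units.val_mul]; exact h.mul hA.1, ?_⟩
  rw [Units.val_mul, ← Matrix.mulVec_mulVec, hA.2, hfix]

lemma shearMat_fix (r s t : ℤ) :
    (shearMat r s t).mulVec ![1, 0, -1, 0] = ![1, 0, -1, 0] := by
  ext i
  fin_cases i <;> simp [shearMat, Matrix.mulVec, dotProduct, Fin.sum_univ_four]

lemma heisMat_fix (k : ℤ) : (heisMat k).mulVec ![1, 0, -1, 0] = ![1, 0, -1, 0] := by
  ext i
  fin_cases i <;> simp [heisMat, Matrix.mulVec, dotProduct, Fin.sum_univ_four]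

lemma transMat_fix (k : ℤ) : (transMat k).mulVec ![1, 0, -1, 0] = ![1, 0, -1, 0] := by
  ext i
  fin_cases i <;> simp [transMat, Matrix.mulVec, dotProduct, Fin.sum_univ_four]

lemma flipMat_fix : flipMat.mulVec ![1, 0, -1, 0] = ![1, 0, -1, 0] := by decide

/-- Elements fixing both `e₁` and `e₃`. -/
lemma mem_closure_of_fix_e1 {A : GL (Fin 4) ℤ} (hA : FixC A) (h0 : (A : M4) 0 0 = 1)
    (h1 : (A : M4) 1 0 = 0) (h2 : (A : M4) 2 0 = 0) : A ∈ Subgroup.closure gensCH := by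
  obtain ⟨⟨c0, c1, c2, c3⟩, ⟨d1, d2, d3⟩, e1, e2, e3⟩ := entries_of_fix hA.1 hA.2
  rw [d1] at c3 e1 e2
  simp only [h0, h1, h2] at c0 c1 c2 c3 d1 e1 e2
  have a11 : (A : M4) 1 1 = 1 := by linarith
  have a31 : (A : M4) 3 1 = 0 := by linarith
  have a13 : (A : M4) 1 3 = 0 := by linarith
  have a33 : (A : M4) 3 3 = 1 := by linarith
  rw [a11, a31, a13, a33] at e3
  have a21 : (A : M4) 2 1 = (A : M4) 0 3 := by linarith
  obtain ⟨g, hg, h⟩ := exists_coe_eq_shearMat ((A : M4) 0 1) ((A : M4) 0 3) ((A : M4) 2 3)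
    hA.1.2.2.1
  have : A = g := by
    apply Units.ext
    rw [h]
    ext i j
    fin_cases i <;> fin_cases j <;> simp [shearMat, *]
  rwa [this]

/-- Elements acting trivially on the image of `e₁` in `c^⊥/c`, for `c = e₁ - e₃`. -/
lemma mem_closure_of_unipotent {A : GL (Fin 4) ℤ} (hA : FixC A)
    (h0 : (A : M4) 0 0 + (A : M4) 2 0 = 1) (h1 : (A : M4) 1 0 = 0) :
    A ∈ Subgroup.closure gensCH := by
  obtain ⟨⟨c0, -, -, -⟩, ⟨d1, -, -⟩, -⟩ := entries_of_fix hA.1 hA.2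
  obtain ⟨k, hk⟩ := hA.1.2.1
  obtain ⟨g, hg, h⟩ := exists_coe_eq_heisMat k
  refine mem_closure_of_mul hg (mem_closure_of_fix_e1 (hA.mul hg (h ▸ heisMat_fix k)) ?_ ?_ ?_) <;>
    simp [h, heisMat, Matrix.mul_apply, Fin.sum_univ_four, h1, d1]
  · linear_combination (-2 * k) * h0 + hk - c0
  · linear_combination (2 * k + 1) * h0 - hk + c0

lemma mem_closure_of_fixC (n : ℕ) : ∀ {A : GL (Fin 4) ℤ}, FixC A →
    ((A : M4) 0 0 + (A : M4) 2 0).natAbs + ((A : M4) 1 0).natAbs = n →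
    A ∈ Subgroup.closure gensCH := by
  induction n using Nat.strong_induction_on with
  | _ n ih =>
  intro A hA hn
  obtain ⟨⟨c0, c1, c2, c3⟩, ⟨d1, d2, d3⟩, e1, e2, -⟩ := entries_of_fix hA.1 hA.2
  have p0 : (2 : ℤ) ∣ (A : M4) 0 0 - 1 := c0 ▸ hA.1.2.1
  have p1 : (2 : ℤ) ∣ (A : M4) 1 0 := c1 ▸ hA.1.2.2.2.1
  have p2 : (2 : ℤ) ∣ (A : M4) 2 0 := hA.1.2.2.2.2.2.1
  by_cases h1 : (A : M4) 1 0 = 0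
  · have hu : ((A : M4) 0 0 + (A : M4) 2 0) * ((A : M4) 3 1 + (A : M4) 1 3 + 1) = 1 := by
      rw [d1, h1] at e1 e2
      linear_combination e1 + e2 - (A : M4) 0 0 * d2 + (A : M4) 2 0 * d3
    rcases Int.eq_one_or_neg_one_of_mul_eq_one hu with h | h
    · exact mem_closure_of_unipotent hA h h1
    · obtain ⟨g, hg, hgf⟩ := exists_coe_eq_flipMat
      refine mem_closure_of_mul hg
        (mem_closure_of_unipotent (hA.mul hg (hgf ▸ flipMat_fix)) ?_ ?_) <;>
        simp [hgf, flipMat, Matrix.mul_apply, Fin.sum_univ_four, h1, d1]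
      linarith
  · rcases lt_or_ge ((A : M4) 1 0).natAbs ((A : M4) 0 0 + (A : M4) 2 0).natAbs with hlt | hge
    · obtain ⟨k, hk⟩ : ∃ k : ℤ, ((A : M4) 0 0 + (A : M4) 2 0 + k * (A : M4) 1 0).natAbs <
          ((A : M4) 0 0 + (A : M4) 2 0).natAbs := by
        rcases le_total 0 (((A : M4) 0 0 + (A : M4) 2 0) * (A : M4) 1 0) with hs | hs
        · refine ⟨-1, ?_⟩
          rcases mul_nonneg_iff.1 hs with h | h <;> omega
        · refine ⟨1, ?_⟩
          rcases mul_nonpos_iff.1 hs with h | h <;> omega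
      obtain ⟨g, hg, h⟩ := exists_coe_eq_shearMat k 0 0 (by simp)
      refine mem_closure_of_mul hg
        (ih _ ?_ (hA.mul hg (h ▸ shearMat_fix k 0 0)) rfl)
      simp [h, shearMat, Matrix.mul_apply, Fin.sum_univ_four]
      rw [add_right_comm]
      omega
    · obtain ⟨k, hk⟩ : ∃ k : ℤ, ((A : M4) 1 0 - 2 * k * ((A : M4) 0 0 + (A : M4) 2 0)).natAbs <
          ((A : M4) 1 0).natAbs := by
        rcases le_total 0 (((A : M4) 0 0 + (A : M4) 2 0) * (A : M4) 1 0) with hs | hs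
        · refine ⟨1, ?_⟩
          rcases mul_nonneg_iff.1 hs with h | h <;> omega
        · refine ⟨-1, ?_⟩
          rcases mul_nonpos_iff.1 hs with h | h <;> omega
      obtain ⟨g, hg, h⟩ := exists_coe_eq_transMat k
      refine mem_closure_of_mul hg
        (ih _ ?_ (hA.mul hg (h ▸ transMat_fix k)) rfl)
      have r0 : ((g * A : GL (Fin 4) ℤ) : M4) 0 0 + ((g * A : GL (Fin 4) ℤ) : M4) 2 0 =
          (A : M4) 0 0 + (A : M4) 2 0 := by
        simp [h, transMat, Matrix.mul_apply, Fin.sum_univ_four, d1]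
        ring
      have r1 : ((g * A : GL (Fin 4) ℤ) : M4) 1 0 =
          (A : M4) 1 0 - 2 * k * ((A : M4) 0 0 + (A : M4) 2 0) := by
        simp [h, transMat, Matrix.mul_apply, Fin.sum_univ_four, d1]
        ring
      rw [r0, r1]
      omega

/-- The stabilizer of `±(e₁−e₃)` in `H_ℤ` is generated by `τ_{e₁}`, `τ_{e₃}`,
`τ_{e₁−e₃}²`, `−I`, `M²·(N′)²`, `M²·(τ_{e₄}τ_{e₃})³` and
`τ_{e₄}·τ_{e₁−e₃}·τ_{e₂}²·τ_{e₁−e₃}⁻¹·τ_{e₄}⁻¹`. -/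
theorem stabilizer_c_klein_eq_closure :
    stabCH = (Subgroup.closure gensCH : Set (GL (Fin 4) ℤ)) := by
  refine Set.Subset.antisymm ?_ closure_le_stabSubgroup
  rintro A ⟨hA, h | h⟩
  · exact mem_closure_of_fixC _ ⟨hA, h⟩ rfl
  · refine mem_closure_of_mul neg_one_mem_closure (mem_closure_of_fixC _ ⟨?_, ?_⟩ rfl)
    · have hneg := ((mem_stabSubgroup _).1 (closure_le_stabSubgroup neg_one_mem_closure)).1
      rw [Units.val_mul]
      exact hneg.mul hA
    · simp only [neg_mul, one_mul, Units.val_neg, Matrix.neg_mulVec, h, neg_neg]
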